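/- arXiv:1801.00111 — 2 statements merged into one kernel-verified Lean document; each statement's English description precedes it below -/
import Mathlib

section
/- Let u and x be arbitrary vertices of a tree T, and let T₂(x) be the multiset of end-vertices v of all walks of length 2 in T starting at x (walks of the form x w v with w ∈ T(x), v ∈ T(w)). Then Σ_{v∈T₂(x)} μ_T(u,v) = Σ_{w∈T(x)} Σ_{v∈T(w)} μ_T(u,v) equals m(T) if x ∈ T(u), and equals 0 if x ∉ T(u). -/
/-! Basic definitions: matchings of a simple graph (as finite sets of edges),
maximum matchings, the number `m(T)` of maximum matchings, alternating paths,
the quantity `μ_T(u,v)`, and generalized inverses of real symmetric matrices. -/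

variable {V : Type*}

/-- `M` is a matching of `G`: a finite set of edges of `G` that are pairwise
vertex-disjoint. -/
def IsMatching (G : SimpleGraph V) (M : Finset (Sym2 V)) : Prop :=
  (∀ e ∈ M, e ∈ G.edgeSet) ∧
    ∀ e ∈ M, ∀ f ∈ M, e ≠ f → ∀ v : V, ¬(v ∈ e ∧ v ∈ f)

/-- `M` is a maximum matching of `G`: a matching of maximum cardinality. -/
def IsMaximumMatching (G : SimpleGraph V) (M : Finset (Sym2 V)) : Prop :=
  IsMatching G M ∧ ∀ M' : Finset (Sym2 V), IsMatching G M' → M'.card ≤ M.card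

/-- `m(G)`: the number of maximum matchings of `G`. -/
noncomputable def numMaxMatchings (G : SimpleGraph V) : ℕ :=
  {M : Finset (Sym2 V) | IsMaximumMatching G M}.ncard

/-- The matching `M` covers the vertex `v`. -/
def Covers (M : Finset (Sym2 V)) (v : V) : Prop := ∃ e ∈ M, v ∈ e

/-- A vertex `u` is saturated in `G` if every maximum matching of `G` covers it. -/
def Saturated (G : SimpleGraph V) (u : V) : Prop :=
  ∀ M : Finset (Sym2 V), IsMaximumMatching G M → Covers M u

/-- `p` is a `u_M v` alternating path: a path whose edges belong alternately to `M`
and not to `M`, with both the first and the last edge in `M` (equivalently, the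
`i`-th edge lies in `M` iff `i` is even, and the length is odd). -/
def IsAltPath (G : SimpleGraph V) (M : Finset (Sym2 V)) {u v : V} (p : G.Walk u v) : Prop :=
  p.IsPath ∧ Odd p.length ∧
    ∀ (i : ℕ) (h : i < p.edges.length), (p.edges.get ⟨i, h⟩ ∈ M ↔ Even i)

/-- There exists a `u_M v` alternating path in `G`. -/
def HasAltPath (G : SimpleGraph V) (M : Finset (Sym2 V)) (u v : V) : Prop :=
  ∃ p : G.Walk u v, IsAltPath G M p

/-- `μ_G(u,v)`: the sign `σ(u,v)` (which is `+1` if `dist(u,v) ≡ 1 (mod 4)` and `-1`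
if `dist(u,v) ≡ 3 (mod 4)`) times the number of maximum matchings `M` of `G` admitting
a `u_M v` alternating path; it is `0` when no such maximum matching exists. -/
noncomputable def muT (G : SimpleGraph V) (u v : V) : ℤ :=
  (if G.dist u v % 4 = 1 then 1 else -1) *
    ({M : Finset (Sym2 V) | IsMaximumMatching G M ∧ HasAltPath G M u v}.ncard : ℤ)

/-- `B` is the generalized inverse of the real symmetric matrix `A`: the (unique)
symmetric matrix `B` with `ABA = A`, `BAB = B` and `AB = BA`. -/
def IsGenInverse {n : Type*} [Fintype n] (A B : Matrix n n ℝ) : Prop :=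
  B.IsSymm ∧ A * B * A = A ∧ B * A * B = B ∧ A * B = B * A

/-- Alternating condition along the path from `u` to `v`, without parity requirement. -/
def AltTo (G : SimpleGraph V) (u : V) (M : Finset (Sym2 V)) (v : V) : Prop :=
  ∃ p : G.Walk u v, p.IsPath ∧
    ∀ (i : ℕ) (h : i < p.edges.length), (p.edges[i] ∈ M ↔ Even i)

theorem path_len {G : SimpleGraph V} (hT : G.IsTree) {u v : V} (p : G.Walk u v)
    (hp : p.IsPath) : p.length = G.dist u v := by
  obtain ⟨q, hq, hl⟩ := hT.connected.exists_path_of_dist u v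
  have := hT.isAcyclic.path_unique ⟨p, hp⟩ ⟨q, hq⟩
  have h2 : p = q := congrArg Subtype.val this
  rw [← hl, h2]

theorem dist_le_of_mem [DecidableEq V] {G : SimpleGraph V} (hT : G.IsTree) {u v x : V}
    (p : G.Walk u v) (hp : p.IsPath) (hx : x ∈ p.support) : G.dist u x ≤ G.dist u v := by
  have h1 := SimpleGraph.dist_le (p.takeUntil x hx)
  have h2 := p.length_takeUntil_le_length hx
  have := path_len hT p hp
  omega

theorem concat_path [DecidableEq V] {G : SimpleGraph V} (hT : G.IsTree) {u v w : V}
    (p : G.Walk u v) (hp : p.IsPath) (h : G.Adj v w) (hd : G.dist u w = G.dist u v + 1) :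
    (p.concat h).IsPath := by
  refine hp.concat (fun hx => ?_) h
  have := dist_le_of_mem hT p hp hx
  omega

theorem hasAlt_iff {G : SimpleGraph V} (hT : G.IsTree) {u v : V} {M : Finset (Sym2 V)} :
    HasAltPath G M u v ↔ AltTo G u M v ∧ Odd (G.dist u v) := by
  constructor
  · rintro ⟨p, hp, ho, h⟩
    exact ⟨⟨p, hp, h⟩, path_len hT p hp ▸ ho⟩
  · rintro ⟨⟨p, hp, h⟩, ho⟩
    exact ⟨p, hp, (path_len hT p hp).symm ▸ ho, h⟩

theorem altTo_self {G : SimpleGraph V} {u : V} {M : Finset (Sym2 V)} : AltTo G u M u :=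
  ⟨SimpleGraph.Walk.nil, by simp, by simp⟩

theorem altTo_step [DecidableEq V] {G : SimpleGraph V} (hT : G.IsTree) {u v w : V}
    {M : Finset (Sym2 V)} (h : G.Adj v w) (hd : G.dist u w = G.dist u v + 1) :
    AltTo G u M w ↔ AltTo G u M v ∧ (s(v, w) ∈ M ↔ Even (G.dist u v)) := by
  have key : ∀ p : G.Walk u v, p.IsPath →
      ((∀ (i : ℕ) (hi : i < (p.concat h).edges.length),
        ((p.concat h).edges[i] ∈ M ↔ Even i)) ↔
       (∀ (i : ℕ) (hi : i < p.edges.length), (p.edges[i] ∈ M ↔ Even i)) ∧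
        (s(v, w) ∈ M ↔ Even (G.dist u v))) := by
    intro p hp
    have hl := path_len hT p hp
    rw [← hl]
    have hlen : p.edges.length = p.length := p.length_edges
    simp only [SimpleGraph.Walk.edges_concat, List.concat_eq_append]
    constructor
    · intro H
      refine ⟨fun i hi => ?_, ?_⟩
      · have := H i (by simp; omega)
        rwa [List.getElem_append_left hi] at this
      · have := H p.length (by simp)
        rw [List.getElem_append_right (by omega)] at this
        simpa using this
    · rintro ⟨H1, H2⟩ i hi
      by_cases hi' : i < p.edges.length
      · rw [List.getElem_append_left hi']; exact H1 i hi'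
      · have : i = p.length := by simp at hi; omega
        subst this
        rw [List.getElem_append_right (by omega)]
        simpa using H2
  constructor
  · rintro ⟨q, hq, H⟩
    obtain ⟨p, hp, hl⟩ := hT.connected.exists_path_of_dist u v
    have := hT.isAcyclic.path_unique ⟨q, hq⟩ ⟨p.concat h, concat_path hT p hp h hd⟩
    have := congrArg Subtype.val this
    simp only at this
    subst this
    have := (key p hp).1 H
    exact ⟨⟨p, hp, this.1⟩, this.2⟩
  · rintro ⟨⟨p, hp, H⟩, H2⟩
    exact ⟨_, concat_path hT p hp h hd, (key p hp).2 ⟨H, H2⟩⟩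

theorem altTo_congr [DecidableEq V] {G : SimpleGraph V} (hT : G.IsTree) {u v : V}
    {M M' : Finset (Sym2 V)}
    (hM : ∀ e, (∀ a ∈ e, G.dist u a ≤ G.dist u v) → (e ∈ M ↔ e ∈ M')) :
    AltTo G u M v ↔ AltTo G u M' v := by
  unfold AltTo
  refine exists_congr fun p => and_congr_right fun hp => ?_
  refine forall_congr' fun i => forall_congr' fun hi => ?_
  rw [hM]
  intro a ha
  exact dist_le_of_mem hT p hp
    (SimpleGraph.Walk.mem_support_of_mem_edges (List.getElem_mem hi) ha)

theorem exists_parent [DecidableEq V] {G : SimpleGraph V} (hT : G.IsTree) {u w : V}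
    (hw : w ≠ u) : ∃ p, G.Adj w p ∧ G.dist u w = G.dist u p + 1 ∧
      ∀ v, G.Adj w v → v ≠ p → G.dist u v = G.dist u w + 1 := by
  obtain ⟨q, hq, hl⟩ := hT.connected.exists_path_of_dist u w
  have hn : ¬ q.Nil := SimpleGraph.Walk.not_nil_of_ne (Ne.symm hw)
  have uniq : ∀ v, G.Adj w v → G.dist u w = G.dist u v + 1 → v = q.penultimate := by
    intro v hv hd
    obtain ⟨r, hr, hl'⟩ := hT.connected.exists_path_of_dist u v
    have := hT.isAcyclic.path_unique ⟨q, hq⟩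
      ⟨r.concat hv.symm, concat_path hT r hr hv.symm hd⟩
    have := congrArg Subtype.val this
    simp only at this
    rw [this]; simp
  have hadj : G.Adj w q.penultimate := (q.adj_penultimate hn).symm
  refine ⟨q.penultimate, hadj, ?_, ?_⟩
  · have h1 := SimpleGraph.dist_le q.dropLast
    have h2 : q.dropLast.length + 1 = q.length := by
      rw [← SimpleGraph.Walk.length_concat _ (q.adj_penultimate hn), q.concat_dropLast]
    rcases hT.dist_eq_dist_add_one_of_adj u hadj with h | h <;> omega
  · intro v hv hne
    rcases hT.dist_eq_dist_add_one_of_adj u hv with h | h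
    · exact absurd (uniq v hv h) hne
    · exact h

theorem root_nbr {G : SimpleGraph V} {u v : V} (h : G.Adj u v) : G.dist u v = 1 :=
  SimpleGraph.dist_eq_one_iff_adj.2 h

theorem match_uniq {G : SimpleGraph V} {M : Finset (Sym2 V)} (hM : IsMatching G M)
    {a b c : V} (h1 : s(a, b) ∈ M) (h2 : s(a, c) ∈ M) : b = c := by
  by_contra hne
  refine hM.2 _ h1 _ h2 (fun h => hne ?_) a ⟨by simp, by simp⟩
  rcases Sym2.eq_iff.1 h with h | h
  · exact h.2
  · exact h.2.trans h.1

open Classical in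
theorem partition [Fintype V] {G : SimpleGraph V}
    (S : Finset (Finset (Sym2 V))) (hS : ∀ M ∈ S, IsMatching G M) (x : V) :
    S.card = (S.filter fun M => ¬ Covers M x).card
      + ∑ v ∈ G.neighborFinset x, (S.filter fun M => s(x, v) ∈ M).card := by
  rw [← Finset.card_filter_add_card_filter_not (s := S) (fun M => ¬ Covers M x)]
  congr 1
  rw [← Finset.card_biUnion]
  · congr 1
    ext M
    simp only [Finset.mem_filter, not_not, Finset.mem_biUnion, SimpleGraph.mem_neighborFinset]
    constructor
    · rintro ⟨hM, e, he, hx⟩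
      obtain ⟨y, rfl⟩ := Sym2.mem_iff_exists.1 hx
      exact ⟨y, (hS M hM).1 _ he, hM, he⟩
    · rintro ⟨y, _, hM, he⟩
      exact ⟨hM, _, he, by simp⟩
  · intro a _ b _ hab
    rw [Function.onFun, Finset.disjoint_left]
    intro M h1 h2
    rw [Finset.mem_filter] at h1 h2
    exact hab (match_uniq (hS M h1.1) h1.2 h2.2)

open Classical in
/-- maximum matchings alternating from `u` to `v` -/
noncomputable def NN [Fintype V] (G : SimpleGraph V) (u v : V) : Finset (Finset (Sym2 V)) :=
  Finset.univ.filter fun M => IsMaximumMatching G M ∧ AltTo G u M v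

open Classical in
/-- those missing `v` -/
noncomputable def QQ [Fintype V] (G : SimpleGraph V) (u v : V) : Finset (Finset (Sym2 V)) :=
  (NN G u v).filter fun M => ¬ Covers M v

theorem mem_NN [Fintype V] {G : SimpleGraph V} {u v : V} {M : Finset (Sym2 V)} :
    M ∈ NN G u v ↔ IsMaximumMatching G M ∧ AltTo G u M v := by simp [NN]

theorem mem_QQ [Fintype V] {G : SimpleGraph V} {u v : V} {M : Finset (Sym2 V)} :
    M ∈ QQ G u v ↔ (IsMaximumMatching G M ∧ AltTo G u M v) ∧ ¬ Covers M v := by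
  simp [QQ, mem_NN]

theorem num_eq [Fintype V] (G : SimpleGraph V) (u : V) :
    numMaxMatchings G = (NN G u u).card := by
  rw [numMaxMatchings, ← Set.ncard_coe_finset]
  congr 1; ext M; simp [mem_NN, altTo_self]

theorem muT_odd [Fintype V] {G : SimpleGraph V} (hT : G.IsTree) {u v : V}
    (h : Odd (G.dist u v)) :
    muT G u v = (if G.dist u v % 4 = 1 then 1 else -1) * ((NN G u v).card : ℤ) := by
  rw [muT, ← Set.ncard_coe_finset]
  congr 3; ext M; simp [mem_NN, hasAlt_iff hT, h]

theorem muT_even {G : SimpleGraph V} (hT : G.IsTree) {u v : V}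
    (h : ¬ Odd (G.dist u v)) : muT G u v = 0 := by
  simp [muT, hasAlt_iff hT, h]

/-- From an odd vertex the next edge is forced out of `M`. -/
theorem odd_step [DecidableEq V] {G : SimpleGraph V} (hT : G.IsTree) {u p w : V}
    {M : Finset (Sym2 V)} (hM : IsMatching G M) (h : G.Adj p w)
    (hd : G.dist u w = G.dist u p + 1) (ho : Odd (G.dist u p)) :
    AltTo G u M w ↔ AltTo G u M p := by
  rw [altTo_step hT h hd]
  refine and_iff_left_of_imp fun ha => ?_
  have hne : p ≠ u := by rintro rfl; simp at ho
  obtain ⟨q, hq, hdq, -⟩ := exists_parent hT hne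
  have := ((altTo_step hT hq.symm hdq).1 ha).2
  have hm : s(q, p) ∈ M := this.2 (by rw [hdq] at ho; exact Nat.odd_add_one.1 ho |> Nat.not_odd_iff_even.1)
  refine iff_of_false (fun hw => ?_) (Nat.not_even_iff_odd.2 ho)
  have : q = w := match_uniq hM (Sym2.eq_swap ▸ hm) hw
  subst this; omega

open Classical in
theorem N_even [Fintype V] {G : SimpleGraph V} (hT : G.IsTree) {u w : V}
    (he : Even (G.dist u w)) :
    (NN G u w).card = (QQ G u w).card + ∑ v ∈ G.neighborFinset w,
      if G.dist u v = G.dist u w + 1 then (NN G u v).card else 0 := by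
  rw [partition (NN G u w) (fun M hM => (mem_NN.1 hM).1.1) w]
  congr 1
  refine Finset.sum_congr rfl fun v hv => ?_
  rw [SimpleGraph.mem_neighborFinset] at hv
  split_ifs with hd
  · congr 1; ext M
    rw [Finset.mem_filter, mem_NN, mem_NN, altTo_step hT hv hd]
    simp [he]; tauto
  · rw [Finset.card_eq_zero, Finset.filter_eq_empty_iff]
    intro M hM hm
    rw [mem_NN] at hM
    have hd' : G.dist u w = G.dist u v + 1 := by
      rcases hT.dist_eq_dist_add_one_of_adj u hv with h | h
      · exact h
      · exact absurd h hd
    have := ((altTo_step hT hv.symm hd').1 hM.2).2.1 (Sym2.eq_swap ▸ hm)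
    rw [hd'] at he
    exact Nat.even_add_one.1 he this

theorem N_odd [Fintype V] [DecidableEq V] {G : SimpleGraph V} (hT : G.IsTree) {u p w : V}
    (h : G.Adj p w) (hd : G.dist u w = G.dist u p + 1) (ho : Odd (G.dist u p)) :
    NN G u w = NN G u p := by
  ext M
  rw [mem_NN, mem_NN]
  exact and_congr_right fun hM => odd_step hT hM.1 h hd ho

/-- swapping an edge -/
theorem swap_max [DecidableEq V] {G : SimpleGraph V} {M : Finset (Sym2 V)}
    (hM : IsMaximumMatching G M) {x a b : V} (ha : s(x, a) ∈ M) (hb : G.Adj x b)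
    (hc : ¬ Covers M b) :
    IsMaximumMatching G (insert s(x, b) (M.erase s(x, a))) ∧
      ¬ Covers (insert s(x, b) (M.erase s(x, a))) a := by
  have hbM : s(x, b) ∉ M := fun h => hc ⟨_, h, by simp⟩
  have hab : a ≠ b := by rintro rfl; exact hbM ha
  have hxa : G.Adj x a := hM.1.1 _ ha
  have aux : ∀ f ∈ M, f ≠ s(x, a) → ∀ v, ¬ (v ∈ s(x, b) ∧ v ∈ f) := by
    rintro f hf hne v ⟨h1, h2⟩
    rcases Sym2.mem_iff.1 h1 with rfl | rfl
    · exact hM.1.2 f hf _ ha hne v ⟨h2, by simp⟩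
    · exact hc ⟨f, hf, h2⟩
  refine ⟨⟨⟨?_, ?_⟩, ?_⟩, ?_⟩
  · intro e he
    rcases Finset.mem_insert.1 he with rfl | he
    · exact hb
    · exact hM.1.1 _ (Finset.mem_of_mem_erase he)
  · intro e he f hf hne v hv
    rw [Finset.mem_insert, Finset.mem_erase] at he hf
    rcases he with rfl | he <;> rcases hf with rfl | hf
    · exact hne rfl
    · exact aux f hf.2 hf.1 v hv
    · exact aux e he.2 he.1 v hv.symm
    · exact hM.1.2 e he.2 f hf.2 hne v hv
  · intro M' hM'
    rw [Finset.card_insert_of_notMem (by simp [hbM]), Finset.card_erase_add_one ha]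
    exact hM.2 M' hM'
  · rintro ⟨e, he, hae⟩
    rw [Finset.mem_insert, Finset.mem_erase] at he
    rcases he with rfl | ⟨h1, h2⟩
    · rcases Sym2.mem_iff.1 hae with h | h
      · exact hxa.ne h.symm
      · exact hab h
    · exact hM.1.2 e h2 _ ha h1 a ⟨hae, by simp⟩

theorem swap_swap [DecidableEq V] {M : Finset (Sym2 V)} {e f : Sym2 V} (he : e ∈ M)
    (hf : f ∉ M) : insert e ((insert f (M.erase e)).erase f) = M := by
  rw [Finset.erase_insert (by simp [hf]), Finset.insert_erase he]

theorem max_covers [DecidableEq V] {G : SimpleGraph V} {M : Finset (Sym2 V)}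
    (hM : IsMaximumMatching G M) {x p : V} (h : G.Adj x p) (hp : ¬ Covers M p) :
    Covers M x := by
  by_contra hx
  have hn : s(x, p) ∉ M := fun h => hp ⟨_, h, by simp⟩
  have : IsMatching G (insert s(x, p) M) := by
    have aux : ∀ f ∈ M, ∀ v, ¬ (v ∈ s(x, p) ∧ v ∈ f) := by
      rintro f hf v ⟨h1, h2⟩
      rcases Sym2.mem_iff.1 h1 with rfl | rfl
      · exact hx ⟨f, hf, h2⟩
      · exact hp ⟨f, hf, h2⟩
    constructor
    · intro e he
      rcases Finset.mem_insert.1 he with rfl | he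
      · exact h
      · exact hM.1.1 _ he
    · intro e he f hf hne v hv
      rw [Finset.mem_insert] at he hf
      rcases he with rfl | he <;> rcases hf with rfl | hf
      · exact hne rfl
      · exact aux f hf v hv
      · exact aux e he v hv.symm
      · exact hM.1.2 e he f hf hne v hv
  have := hM.2 _ this
  rw [Finset.card_insert_of_notMem hn] at this
  omega

theorem alt_swap [DecidableEq V] {G : SimpleGraph V} (hT : G.IsTree) {u p x a b : V}
    {M : Finset (Sym2 V)} (hd : G.dist u x = G.dist u p + 1) :
    AltTo G u (insert s(x, b) (M.erase s(x, a))) p ↔ AltTo G u M p := by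
  refine altTo_congr hT fun e he => ?_
  have h : ∀ y, e ≠ s(x, y) := by
    rintro y rfl
    have := he x (by simp)
    omega
  simp [h]

open Classical in
theorem Q_odd [Fintype V] {G : SimpleGraph V} (hT : G.IsTree) {u p x : V}
    (h : G.Adj x p) (hd : G.dist u x = G.dist u p + 1) (ho : Odd (G.dist u x))
    (hch : ∀ v, G.Adj x v → v ≠ p → G.dist u v = G.dist u x + 1) :
    (QQ G u p).card = ∑ w ∈ (G.neighborFinset x).erase p, (QQ G u w).card := by
  have hep : Even (G.dist u p) := by
    rw [hd] at ho; exact Nat.not_odd_iff_even.1 (Nat.odd_add_one.1 ho)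
  rw [partition (QQ G u p) (fun M hM => (mem_QQ.1 hM).1.1.1) x]
  have h0 : ((QQ G u p).filter fun M => ¬ Covers M x) = ∅ := by
    rw [Finset.filter_eq_empty_iff]
    intro M hM
    rw [mem_QQ] at hM
    exact not_not.2 (max_covers hM.1.1 h hM.2)
  rw [h0, Finset.card_empty, zero_add,
    ← Finset.add_sum_erase _ _ ((SimpleGraph.mem_neighborFinset _ _ _).2 h)]
  have h1 : ((QQ G u p).filter fun M => s(x, p) ∈ M) = ∅ := by
    rw [Finset.filter_eq_empty_iff]
    intro M hM hm
    rw [mem_QQ] at hM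
    exact hM.2 ⟨_, hm, by simp⟩
  rw [h1, Finset.card_empty, zero_add]
  refine Finset.sum_congr rfl fun w hw => ?_
  rw [Finset.mem_erase, SimpleGraph.mem_neighborFinset] at hw
  have hdw := hch w hw.2 hw.1
  have hQ : ∀ M, M ∈ QQ G u w ↔ IsMaximumMatching G M ∧ AltTo G u M p ∧ s(x, p) ∈ M ∧
      ¬ Covers M w := by
    intro M
    rw [mem_QQ, and_assoc]
    refine and_congr_right fun hM => ?_
    rw [odd_step hT hM.1 hw.2 hdw ho, altTo_step hT h.symm hd, and_assoc, Sym2.eq_swap]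
    simp [hep]
  refine Finset.card_nbij' (fun M => insert s(x, p) (M.erase s(x, w)))
    (fun M => insert s(x, w) (M.erase s(x, p))) ?_ ?_ ?_ ?_
  · intro M hM
    simp only [Finset.coe_filter, Set.mem_ofPred_eq, mem_QQ] at hM
    obtain ⟨⟨⟨hm, ha⟩, hc⟩, hs⟩ := hM
    have := swap_max hm hs h hc
    rw [Finset.mem_coe, hQ]
    exact ⟨this.1, (alt_swap hT hd).2 ha, by simp, this.2⟩
  · intro M hM
    rw [Finset.mem_coe, hQ] at hM
    obtain ⟨hm, ha, hs, hc⟩ := hM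
    have := swap_max hm hs hw.2 hc
    simp only [Finset.coe_filter, Set.mem_ofPred_eq, mem_QQ]
    exact ⟨⟨⟨this.1, (alt_swap hT hd).2 ha⟩, this.2⟩, by simp⟩
  · intro M hM
    simp only [Finset.coe_filter, Set.mem_ofPred_eq, mem_QQ] at hM
    exact swap_swap hM.2 fun h => hM.1.2 ⟨_, h, by simp⟩
  · intro M hM
    rw [Finset.mem_coe, hQ] at hM
    exact swap_swap hM.2.2.1 fun h => hM.2.2.2 ⟨_, h, by simp⟩

theorem inner_mu_sum [Fintype V] [DecidableEq V] {G : SimpleGraph V} [DecidableRel G.Adj]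
    (hT : G.IsTree) {u w : V} {j : ℕ} (hj : G.dist u w = 2 * j) :
    ∑ v ∈ G.neighborFinset w, muT G u v =
      (if w = u then (numMaxMatchings G : ℤ) else 0) - (-1) ^ j * ((QQ G u w).card : ℤ) := by
  have hN := N_even hT (u := u) (w := w) ⟨j, by omega⟩
  have hN' : ((NN G u w).card : ℤ) = (QQ G u w).card + ∑ v ∈ G.neighborFinset w,
      if G.dist u v = G.dist u w + 1 then ((NN G u v).card : ℤ) else 0 := by
    rw [hN]; push_cast; congr 1
    refine Finset.sum_congr ?_ fun _ _ => rfl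
    ext; simp
  have hsgn : ∀ v, G.dist u v = G.dist u w + 1 → muT G u v = (-1) ^ j * ((NN G u v).card : ℤ) := by
    intro v hv
    rw [muT_odd hT ⟨j, by omega⟩]
    congr 1
    rcases Nat.even_or_odd j with hj' | hj'
    · rw [hj'.neg_one_pow, if_pos]
      obtain ⟨k, hk⟩ := hj'; omega
    · rw [hj'.neg_one_pow, if_neg]
      obtain ⟨k, hk⟩ := hj'; omega
  by_cases hwu : w = u
  · subst hwu
    rw [if_pos rfl, num_eq G w, hN']
    have : j = 0 := by simpa using hj.symm
    subst this
    simp only [pow_zero, one_mul, add_sub_cancel_left] at hsgn ⊢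
    refine Finset.sum_congr rfl fun v hv => ?_
    have h1 := root_nbr ((SimpleGraph.mem_neighborFinset _ _ _).1 hv)
    rw [if_pos (by simpa using h1), hsgn v (by simpa using h1)]
  · obtain ⟨p, hp, hd, hch⟩ := exists_parent hT hwu
    have ho : Odd (G.dist u p) := by
      rcases j with _ | j
      · omega
      · exact ⟨j, by omega⟩
    have hpm := (SimpleGraph.mem_neighborFinset G w p).2 hp
    rw [N_odd hT hp.symm hd ho] at hN'
    rw [← Finset.add_sum_erase _ _ hpm] at hN' ⊢
    rw [if_neg (by omega), zero_add] at hN'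
    have hmp : muT G u p = - (-1) ^ j * ((NN G u p).card : ℤ) := by
      rw [muT_odd hT ho]
      congr 1
      rcases Nat.even_or_odd j with hj' | hj'
      · rw [hj'.neg_one_pow, if_neg]
        obtain ⟨k, hk⟩ := hj'; omega
      · rw [hj'.neg_one_pow, if_pos]
        · simp
        obtain ⟨k, hk⟩ := hj'; omega
    have hs : ∑ v ∈ (G.neighborFinset w).erase p, muT G u v = (-1) ^ j *
        ∑ v ∈ (G.neighborFinset w).erase p,
          (if G.dist u v = G.dist u w + 1 then ((NN G u v).card : ℤ) else 0) := by
      rw [Finset.mul_sum]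
      refine Finset.sum_congr rfl fun v hv => ?_
      rw [Finset.mem_erase, SimpleGraph.mem_neighborFinset] at hv
      have := hch v hv.2 hv.1
      rw [if_pos this, hsgn v this]
    rw [hmp, hs, if_neg hwu, hN']
    ring

/-- Let `u` and `x` be arbitrary vertices of a tree `T`. Then
`∑_{w∈T(x)} ∑_{v∈T(w)} μ_T(u,v)` (the sum of `μ_T(u,v)` over the multiset `T₂(x)` of
endpoints of length-2 walks from `x`) equals `m(T)` if `x ∈ T(u)`, and `0` otherwise. -/
theorem stmt5 {V : Type*} [Fintype V] [DecidableEq V] (G : SimpleGraph V)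
    [DecidableRel G.Adj] (hT : G.IsTree) (hV : 2 ≤ Fintype.card V)
    (u x : V) :
    ∑ w ∈ G.neighborFinset x, ∑ v ∈ G.neighborFinset w, muT G u v
      = if G.Adj u x then (numMaxMatchings G : ℤ) else 0 := by
  rcases Nat.even_or_odd (G.dist u x) with hx | hx
  · have hna : ¬ G.Adj u x := by
      intro h
      rw [root_nbr h] at hx
      exact absurd hx (by decide)
    rw [if_neg hna]
    refine Finset.sum_eq_zero fun w hw => Finset.sum_eq_zero fun v hv => muT_even hT ?_
    rw [SimpleGraph.mem_neighborFinset] at hw hv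
    rw [Nat.not_odd_iff_even]
    have h1 := hT.dist_eq_dist_add_one_of_adj u hw
    have h2 := hT.dist_eq_dist_add_one_of_adj u hv
    rw [Nat.even_iff] at *
    omega
  · have hxu : x ≠ u := by rintro rfl; simp at hx
    obtain ⟨p, hp, hd, hch⟩ := exists_parent hT hxu
    obtain ⟨j, hj⟩ := hx
    have hQ := Q_odd hT hp hd ⟨j, hj⟩ hch
    have hQ' : ((QQ G u p).card : ℤ) =
        ∑ w ∈ (G.neighborFinset x).erase p, ((QQ G u w).card : ℤ) := by
      rw [hQ]; push_cast
      refine Finset.sum_congr ?_ fun _ _ => rfl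
      ext; simp
    have hpm := (SimpleGraph.mem_neighborFinset G x p).2 hp
    have e1 : ∀ w ∈ G.neighborFinset x, ∑ v ∈ G.neighborFinset w, muT G u v =
        (if w = u then (numMaxMatchings G : ℤ) else 0) -
          (if w = p then (-1) ^ j else (-1) ^ (j + 1)) * ((QQ G u w).card : ℤ) := by
      intro w hw
      rw [SimpleGraph.mem_neighborFinset] at hw
      split_ifs with h1 h2 h2 <;> first
        | (rw [inner_mu_sum hT (j := j) (by subst h2; omega)]; simp [h1])
        | (rw [inner_mu_sum hT (j := j + 1) (by have := hch w hw h2; omega)]; simp [h1])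
    rw [Finset.sum_congr rfl e1, Finset.sum_sub_distrib]
    have e2 : ∑ w ∈ G.neighborFinset x,
        (if w = p then (-1 : ℤ) ^ j else (-1) ^ (j + 1)) * ((QQ G u w).card : ℤ) = 0 := by
      rw [← Finset.add_sum_erase _ _ hpm, if_pos rfl, hQ', Finset.mul_sum, ← Finset.sum_add_distrib]
      refine Finset.sum_eq_zero fun w hw => ?_
      rw [if_neg (Finset.ne_of_mem_erase hw)]
      ring
    rw [e2, sub_zero, Finset.sum_ite_eq']
    simp [SimpleGraph.adj_comm]
end

section
/- Let T be a tree with vertex set V and let u ∈ V be a saturated vertex. Then every function f : V → ℝ satisfies Σ_{v∈V} μ_T(u,v) Σ_{w∈T(v)} f(w) = m(T)·f(u). -/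
/-! Basic definitions: matchings of a simple graph (as finite sets of edges),
maximum matchings, the number `m(T)` of maximum matchings, alternating paths,
the quantity `μ_T(u,v)`, and generalized inverses of real symmetric matrices. -/

variable {V : Type*}

open Classical in
theorem swap_step {V : Type*} (G : SimpleGraph V) (M : Finset (Sym2 V))
    (hM : IsMaximumMatching G M) (x p w : V) (hxp : s(x, p) ∈ M) (hpw : G.Adj p w)
    (hxw : x ≠ w) (hw : ¬ Covers M w) :
    IsMaximumMatching G (insert s(p, w) (M.erase s(x, p))) ∧
      ¬ Covers (insert s(p, w) (M.erase s(x, p))) x := by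
  obtain ⟨⟨h1, h2⟩, h3⟩ := hM
  have hpwM : s(p, w) ∉ M := fun h => hw ⟨_, h, by simp⟩
  have hxpadj : G.Adj x p := by simpa using h1 _ hxp
  have hcard : (insert s(p, w) (M.erase s(x, p))).card = M.card := by
    rw [Finset.card_insert_of_notMem (by simp [hpwM]), Finset.card_erase_add_one hxp]
  have key : ∀ f ∈ M.erase s(x, p), ∀ v, v ∈ s(p, w) → v ∉ f := by
    intro f hf v hv hvf
    obtain ⟨hf1, hf2⟩ := Finset.mem_erase.1 hf
    rcases Sym2.mem_iff.1 hv with rfl | rfl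
    · exact h2 f hf2 _ hxp hf1 v ⟨hvf, by simp⟩
    · exact hw ⟨f, hf2, hvf⟩
  refine ⟨⟨⟨?_, ?_⟩, fun M' hM' => hcard ▸ h3 M' hM'⟩, ?_⟩
  · intro e he
    rcases Finset.mem_insert.1 he with rfl | he
    · simpa using hpw
    · exact h1 _ (Finset.mem_of_mem_erase he)
  · intro e he f hf hef v hv
    rcases Finset.mem_insert.1 he with rfl | he <;> rcases Finset.mem_insert.1 hf with rfl | hf
    · exact hef rfl
    · exact key f hf v hv.1 hv.2
    · exact key e he v hv.2 hv.1
    · exact h2 e (Finset.mem_of_mem_erase he) f (Finset.mem_of_mem_erase hf) hef v hv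
  · rintro ⟨e, he, hxe⟩
    rcases Finset.mem_insert.1 he with rfl | he
    · rcases Sym2.mem_iff.1 hxe with h | h
      · exact hxpadj.ne h
      · exact hxw h
    · obtain ⟨hf1, hf2⟩ := Finset.mem_erase.1 he
      exact h2 e hf2 _ hxp hf1 x ⟨hxe, by simp⟩

theorem alt_swap_s6 {V : Type*} (G : SimpleGraph V) (x : ℕ → V) (n : ℕ) :
    ∀ (M : Finset (Sym2 V)), Set.InjOn x {i | i ≤ 2 * n} →
    (∀ i < 2 * n, G.Adj (x i) (x (i + 1))) →
    (∀ i < n, s(x (2 * i), x (2 * i + 1)) ∈ M) → IsMaximumMatching G M →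
    ¬ Covers M (x (2 * n)) → ∃ M', IsMaximumMatching G M' ∧ ¬ Covers M' (x 0) := by
  classical
  induction n with
  | zero => intro M _ _ _ h1 h2; exact ⟨M, h1, h2⟩
  | succ n ih =>
    intro M hinj hadj hmem hM hc
    have hinj' : ∀ i j, i ≤ 2 * (n + 1) → j ≤ 2 * (n + 1) → x i = x j → i = j :=
      fun i j hi hj h => hinj hi hj h
    have := swap_step G M hM (x (2 * n)) (x (2 * n + 1)) (x (2 * (n + 1))) (hmem n (by omega))
      (hadj (2 * n + 1) (by omega)) (fun h => by have := hinj' _ _ (by omega) (by omega) h; omega) hc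
    refine ih _ (fun i hi j hj h => ?_) (fun i hi => hadj i (by omega)) ?_ this.1 this.2
    · simp only [Set.mem_ofPred_eq] at hi hj
      exact hinj' i j (by omega) (by omega) h
    · intro i hi
      refine Finset.mem_insert_of_mem (Finset.mem_erase.2 ⟨?_, hmem i (by omega)⟩)
      intro h
      rcases Sym2.eq_iff.1 h with h | h
      · have := hinj' _ _ (by omega) (by omega) h.1; omega
      · have := hinj' _ _ (by omega) (by omega) h.1; omega

theorem tree_path_eq {V : Type*} {G : SimpleGraph V} (hT : G.IsTree) {u v : V}
    {p q : G.Walk u v} (hp : p.IsPath) (hq : q.IsPath) : p = q :=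
  (hT.existsUnique_path u v).unique hp hq

theorem tree_dist {V : Type*} {G : SimpleGraph V} (hT : G.IsTree) {u v : V}
    {p : G.Walk u v} (hp : p.IsPath) : G.dist u v = p.length := by
  obtain ⟨q, hq, hl⟩ := (hT.connected u v).exists_path_of_dist
  rw [tree_path_eq hT hp hq, hl]

theorem hasAlt_iff_s6 {V : Type*} {G : SimpleGraph V} (hT : G.IsTree) (M : Finset (Sym2 V)) {u v : V}
    {p : G.Walk u v} (hp : p.IsPath) : HasAltPath G M u v ↔ (Odd p.length ∧
      ∀ i < p.length, (s(p.getVert i, p.getVert (i + 1)) ∈ M ↔ Even i)) := by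
  have : HasAltPath G M u v ↔ IsAltPath G M p :=
    ⟨fun ⟨q, hq⟩ => tree_path_eq hT hp hq.1 ▸ hq, fun h => ⟨p, h⟩⟩
  rw [this]
  simp only [IsAltPath, hp, true_and, List.get_eq_getElem, SimpleGraph.Walk.length_edges,
    SimpleGraph.Walk.getElem_edges]

open Classical in
theorem inner_zero {V : Type*} [Fintype V] (G : SimpleGraph V)
    (hT : G.IsTree) (u : V) (hu : Saturated G u) (M : Finset (Sym2 V))
    (hM : IsMaximumMatching G M) (p w : V) (Q : G.Walk u p) (hpw : G.Adj p w)
    (hP : (Q.concat hpw).IsPath) :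
    ∑ v ∈ G.neighborFinset w, ((if G.dist u v % 4 = 1 then 1 else -1) *
      (if HasAltPath G M u v then 1 else 0) : ℝ) = 0 := by
  have hQ : Q.IsPath := ((SimpleGraph.Walk.concat_isPath_iff hpw).1 hP).1
  have hR : ∀ v (h : G.Adj w v), v ≠ p → ((Q.concat hpw).concat h).IsPath := by
    intro v h hv
    refine hP.concat (fun hs => hv ?_) h
    simpa using hT.isAcyclic.eq_penultimate_of_adj_end hP h hs
  have hiff : ∀ v, G.Adj w v → v ≠ p → (HasAltPath G M u v ↔
      HasAltPath G M u p ∧ s(p, w) ∉ M ∧ s(w, v) ∈ M) := by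
    intro v h hv
    rw [hasAlt_iff_s6 hT M (hR v h hv), hasAlt_iff_s6 hT M hQ]
    simp only [SimpleGraph.Walk.length_concat]
    have e1 : ∀ i ≤ Q.length, ((Q.concat hpw).concat h).getVert i = Q.getVert i := by
      intro i hi
      simp only [SimpleGraph.Walk.concat_eq_append]
      rw [SimpleGraph.Walk.getVert_append, if_pos (by simp; omega),
        SimpleGraph.Walk.getVert_append]
      split_ifs with h'
      · rfl
      · have : i = Q.length := by omega
        subst this; simp
    have e2 : ((Q.concat hpw).concat h).getVert (Q.length + 1) = w := by
      simp only [SimpleGraph.Walk.concat_eq_append]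
      rw [SimpleGraph.Walk.getVert_append]
      simp
    have e3 : ((Q.concat hpw).concat h).getVert (Q.length + 1 + 1) = v := by
      rw [← SimpleGraph.Walk.length_concat Q hpw, ← SimpleGraph.Walk.length_concat _ h]
      exact SimpleGraph.Walk.getVert_length _
    have e4 := e1 _ le_rfl
    rw [SimpleGraph.Walk.getVert_length] at e4
    constructor
    · rintro ⟨ho, ha⟩
      have ho' : Odd Q.length := by grind
      refine ⟨⟨ho', fun i hi => ?_⟩, ?_, ?_⟩
      · have := ha i (by omega)
        rwa [e1 i (by omega), e1 (i + 1) (by omega)] at this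
      · have := ha Q.length (by omega)
        rw [e4, e2] at this
        grind
      · have := ha (Q.length + 1) (by omega)
        rw [e2, e3] at this
        grind
    · rintro ⟨⟨ho, ha⟩, hb, hc⟩
      refine ⟨by grind, fun i hi => ?_⟩
      rcases lt_trichotomy i Q.length with h' | h' | h'
      · rw [e1 i (by omega), e1 (i + 1) (by omega)]
        exact ha i h'
      · subst h'
        rw [e4, e2]; grind
      · have : i = Q.length + 1 := by omega
        subst this
        rw [e2, e3]; grind
  by_cases hA : HasAltPath G M u p
  swap
  · refine Finset.sum_eq_zero fun v hv => ?_
    have hv' : G.Adj w v := by simpa using hv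
    rw [if_neg (c := HasAltPath G M u v), mul_zero]
    by_cases h : v = p
    · rwa [h]
    · rw [hiff v hv' h]; tauto
  have hA' := (hasAlt_iff_s6 hT M hQ).1 hA
  obtain ⟨ho, ha⟩ := hA'
  obtain ⟨⟨hm1, hm2⟩, hm3⟩ := id hM
  obtain ⟨k, hk⟩ := ho
  -- the last edge is in `M`
  have hwn : w ∉ Q.support := ((SimpleGraph.Walk.concat_isPath_iff hpw).1 hP).2
  have hlast : s(Q.getVert (2 * k), p) ∈ M := by
    have := (ha (2 * k) (by omega)).2 (by simp)
    rwa [← hk, SimpleGraph.Walk.getVert_length] at this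
  have hpwM : s(p, w) ∉ M := by
    intro h
    refine hm2 _ hlast _ h ?_ p (by simp)
    intro h'
    rcases Sym2.eq_iff.1 h' with h' | h'
    · exact hpw.ne h'.2
    · exact hwn (h'.1 ▸ Q.getVert_mem_support _)
  have hcov : Covers M w := by
    by_contra hc
    have hlen : (Q.concat hpw).length = 2 * (k + 1) := by
      rw [SimpleGraph.Walk.length_concat]; omega
    obtain ⟨M', h1, h2⟩ := alt_swap_s6 G (Q.concat hpw).getVert (k + 1) M
      (by rw [← hlen]; exact hP.getVert_injOn)
      (fun i hi => (Q.concat hpw).adj_getVert_succ (by omega))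
      (by
        intro i hi
        have := (ha (2 * i) (by omega)).2 (by simp)
        have e1 : ∀ i ≤ Q.length, (Q.concat hpw).getVert i = Q.getVert i := by
          intro i hi
          rw [SimpleGraph.Walk.concat_eq_append, SimpleGraph.Walk.getVert_append]
          split_ifs with h'
          · rfl
          · have : i = Q.length := by omega
            subst this; simp
        rwa [e1 _ (by omega), e1 _ (by omega)])
      hM (by rw [← hlen, SimpleGraph.Walk.getVert_length]; exact hc)
    rw [SimpleGraph.Walk.getVert_zero] at h2
    exact h2 (hu M' h1)
  obtain ⟨e, he, hwe⟩ := hcov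
  obtain ⟨v₀, rfl⟩ := hwe
  have hadj₀ : G.Adj w v₀ := by simpa using hm1 _ he
  have hne : v₀ ≠ p := by
    rintro rfl
    exact hpwM (by rwa [Sym2.eq_swap])
  have hA₀ : HasAltPath G M u v₀ := (hiff v₀ hadj₀ hne).2 ⟨hA, hpwM, he⟩
  rw [Finset.sum_eq_add_of_mem p v₀ (by simpa using hpw.symm) (by simpa using hadj₀) hne.symm]
  · rw [if_pos hA, if_pos hA₀, tree_dist hT hQ, tree_dist hT (hR v₀ hadj₀ hne)]
    simp only [SimpleGraph.Walk.length_concat]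
    split_ifs <;> first | omega | norm_num
  · rintro v hv ⟨hv1, hv2⟩
    have hv' : G.Adj w v := by simpa using hv
    rw [if_neg (c := HasAltPath G M u v), mul_zero]
    rw [hiff v hv' hv1]
    rintro ⟨-, -, h⟩
    refine hm2 _ he _ h ?_ w (by simp)
    intro h'
    exact hv2 (Sym2.congr_right.1 h').symm

open Classical in
theorem inner_self {V : Type*} [Fintype V] (G : SimpleGraph V)
    (hT : G.IsTree) (u : V) (hu : Saturated G u) (M : Finset (Sym2 V))
    (hM : IsMaximumMatching G M) :
    ∑ v ∈ G.neighborFinset u, ((if G.dist u v % 4 = 1 then 1 else -1) *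
      (if HasAltPath G M u v then 1 else 0) : ℝ) = 1 := by
  have hiff : ∀ v, G.Adj u v → (HasAltPath G M u v ↔ s(u, v) ∈ M) := by
    intro v h
    rw [hasAlt_iff_s6 hT M (SimpleGraph.Path.singleton h).2]
    simp [SimpleGraph.Path.singleton]
  obtain ⟨e, he, hue⟩ := hu M hM
  obtain ⟨v₀, rfl⟩ := hue
  obtain ⟨⟨hm1, hm2⟩, hm3⟩ := hM
  have hadj₀ : G.Adj u v₀ := by simpa using hm1 _ he
  rw [Finset.sum_eq_single_of_mem v₀ (by simpa using hadj₀)]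
  · rw [if_pos ((hiff v₀ hadj₀).2 he), SimpleGraph.dist_eq_one_iff_adj.2 hadj₀]
    norm_num
  · intro v hv hne
    rw [if_neg (c := HasAltPath G M u v), mul_zero]
    rw [hiff v (by simpa using hv)]
    intro h
    refine hm2 _ he _ h ?_ u (by simp)
    intro h'
    exact hne (Sym2.congr_right.1 h').symm

open Classical in
theorem inner_all {V : Type*} [Fintype V] (G : SimpleGraph V)
    (hT : G.IsTree) (u : V) (hu : Saturated G u) (M : Finset (Sym2 V))
    (hM : IsMaximumMatching G M) (w : V) :
    ∑ v ∈ G.neighborFinset w, ((if G.dist u v % 4 = 1 then 1 else -1) *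
      (if HasAltPath G M u v then 1 else 0) : ℝ) = if w = u then 1 else 0 := by
  split_ifs with h
  · subst h; exact inner_self G hT w hu M hM
  · obtain ⟨P, hP, -⟩ := hT.existsUnique_path u w
    have hn : ¬ P.Nil := SimpleGraph.Walk.not_nil_of_ne (Ne.symm h)
    exact inner_zero G hT u hu M hM P.penultimate w P.dropLast (P.adj_penultimate hn)
      (by rwa [SimpleGraph.Walk.concat_dropLast])

/-- Let `T` be a tree with vertex set `V` and let `u` be a saturated vertex.
Then every function `f : V → ℝ` satisfies
`∑_{v∈V} μ_T(u,v) ∑_{w∈T(v)} f(w) = m(T)·f(u)`. -/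
theorem stmt6 {V : Type*} [Fintype V] [DecidableEq V] (G : SimpleGraph V)
    [DecidableRel G.Adj] (hT : G.IsTree) (hV : 2 ≤ Fintype.card V)
    (u : V) (hu : Saturated G u) (f : V → ℝ) :
    ∑ v : V, (muT G u v : ℝ) * ∑ w ∈ G.neighborFinset v, f w
      = (numMaxMatchings G : ℝ) * f u := by
  classical
  have hmu : ∀ v, (muT G u v : ℝ) = ∑ M : Finset (Sym2 V) with IsMaximumMatching G M,
      ((if G.dist u v % 4 = 1 then 1 else -1) * (if HasAltPath G M u v then 1 else 0) : ℝ) := by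
    intro v
    rw [← Finset.mul_sum, Finset.sum_boole, Finset.filter_filter, muT,
      Set.ncard_eq_toFinset_card', Set.toFinset_ofPred]
    push_cast
    rfl
  have hnum : (numMaxMatchings G : ℝ) =
      ∑ M : Finset (Sym2 V) with IsMaximumMatching G M, (1 : ℝ) := by
    rw [numMaxMatchings, Set.ncard_eq_toFinset_card', Set.toFinset_ofPred]
    simp
  have hsw : ∀ g : V → ℝ, ∑ v, g v * ∑ w ∈ G.neighborFinset v, f w =
      ∑ w, (∑ v ∈ G.neighborFinset w, g v) * f w := by
    intro g
    simp only [Finset.mul_sum, Finset.sum_mul, SimpleGraph.neighborFinset_eq_filter,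
      Finset.sum_filter, ite_mul, mul_ite, zero_mul, mul_zero]
    rw [Finset.sum_comm]
    simp only [G.adj_comm]
  rw [hsw, hnum, Finset.sum_mul]
  simp only [hmu]
  have h2 : ∀ w, ∑ v ∈ G.neighborFinset w, ∑ M : Finset (Sym2 V) with IsMaximumMatching G M,
      ((if G.dist u v % 4 = 1 then 1 else -1) * (if HasAltPath G M u v then 1 else 0) : ℝ) =
      ∑ M : Finset (Sym2 V) with IsMaximumMatching G M, if w = u then (1 : ℝ) else 0 := by
    intro w
    rw [Finset.sum_comm]
    refine Finset.sum_congr rfl fun M hM => ?_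
    have := inner_all G hT u hu M (by simpa using hM) w
    convert this
  simp only [h2]
  rw [Finset.sum_eq_single u]
  · simp
  · intro w _ hw; simp [hw]
  · simp
end
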